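/- For all natural numbers n and d with 1 ≤ d < n, the Johnson graph J(n,d) has a Hamiltonian path; that is, there exists an enumeration S_1, …, S_T (T = C(n,d)) of all d-element subsets of {1,…,n} in which every d-element subset appears exactly once and |S_t ∩ S_{t+1}| = d−1 for all 1 ≤ t ≤ T−1. -/

import Mathlib

/-- The revolving door list of the `k`-element subsets of `{0, …, n - 1}`. -/
def revolvingDoor : ℕ → ℕ → List (Finset ℕ)
  | _, 0 => [∅]
  | 0, _ + 1 => []
  | n + 1, k + 1 => revolvingDoor n (k + 1) ++ (revolvingDoor n k).reverse.map (insert n)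

namespace revolvingDoor

@[simp] lemma zero_right (n : ℕ) : revolvingDoor n 0 = [∅] := by cases n <;> rfl

@[simp] lemma zero_succ (k : ℕ) : revolvingDoor 0 (k + 1) = [] := rfl

lemma succ_succ (n k : ℕ) : revolvingDoor (n + 1) (k + 1) =
    revolvingDoor n (k + 1) ++ (revolvingDoor n k).reverse.map (insert n) := rfl

lemma length_eq (n k : ℕ) : (revolvingDoor n k).length = n.choose k := by
  induction n generalizing k with
  | zero => cases k <;> simp
  | succ n ih =>
    cases k with
    | zero => simp
    | succ k => simp [succ_succ, ih, Nat.choose_succ_succ, add_comm]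

lemma mem_iff (n k : ℕ) (A : Finset ℕ) :
    A ∈ revolvingDoor n k ↔ A ∈ Finset.powersetCard k (Finset.range n) := by
  induction n generalizing k A with
  | zero =>
    cases k with
    | zero => simp
    | succ k => simp [Finset.powersetCard_eq_empty.2 (show (∅ : Finset ℕ).card < k + 1 by simp),
        -Finset.mem_powersetCard]
  | succ n ih =>
    cases k with
    | zero => simp
    | succ k =>
      rw [succ_succ, Finset.range_add_one, Finset.powersetCard_succ_insert (by simp)]
      simp [ih]

lemma subset_range {n k : ℕ} {A : Finset ℕ} (h : A ∈ revolvingDoor n k) :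
    A ⊆ Finset.range n :=
  (Finset.mem_powersetCard.1 ((mem_iff n k A).1 h)).1

lemma card_eq {n k : ℕ} {A : Finset ℕ} (h : A ∈ revolvingDoor n k) : A.card = k :=
  (Finset.mem_powersetCard.1 ((mem_iff n k A).1 h)).2

lemma nodup (n k : ℕ) : (revolvingDoor n k).Nodup := by
  have h : (revolvingDoor n k).toFinset = Finset.powersetCard k (Finset.range n) := by
    ext A
    simp only [List.mem_toFinset, mem_iff]
  rw [← Multiset.coe_nodup, ← Multiset.toFinset_card_eq_card_iff_nodup]
  simp [h, length_eq]

lemma eq_nil {n k : ℕ} (h : n < k) : revolvingDoor n k = [] := by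
  rw [← List.length_eq_zero_iff, length_eq, Nat.choose_eq_zero_of_lt h]

lemma self_eq (n : ℕ) : revolvingDoor n n = [Finset.range n] := by
  induction n with
  | zero => simp
  | succ n ih => simp [succ_succ, eq_nil, ih, Finset.range_add_one]

lemma head?_eq {n k : ℕ} (h : k ≤ n) : (revolvingDoor n k).head? = some (Finset.range k) := by
  induction n, h using Nat.le_induction with
  | base => simp [self_eq]
  | succ n h ih =>
    cases k with
    | zero => simp
    | succ k => simp [succ_succ, ih]

lemma getLast?_eq {n k : ℕ} (h : k ≤ n) :
    (revolvingDoor (n + 1) (k + 1)).getLast? = some (insert n (Finset.range k)) := by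
  simp [succ_succ, head?_eq h]

lemma isChain (n k : ℕ) :
    (revolvingDoor n k).IsChain (fun A B => (A ∩ B).card + 1 = k) := by
  induction n generalizing k with
  | zero => cases k <;> simp
  | succ n ih =>
    cases k with
    | zero => simp
    | succ k =>
      rw [succ_succ, List.isChain_append]
      refine ⟨ih _, ?_, ?_⟩
      · rw [List.isChain_map, List.isChain_reverse]
        refine ((ih k).imp_of_mem_imp ?_)
        intro A B hA hB hAB
        have hn : n ∉ B ∩ A := fun h => by
          simpa using subset_range hA (Finset.mem_inter.1 h).2
        rw [← Finset.insert_inter_distrib, Finset.card_insert_of_notMem hn, Finset.inter_comm, hAB]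
      · intro A hA B hB
        rcases Nat.lt_or_ge n (k + 1) with h | h
        · simp [eq_nil h] at hA
        obtain ⟨m, rfl⟩ : ∃ m, n = m + 1 := ⟨n - 1, by omega⟩
        rw [getLast?_eq (by omega)] at hA
        cases k with
        | zero =>
          simp at hA hB
          subst hA hB
          simp
        | succ j =>
          simp only [List.head?_map, List.head?_reverse,
            getLast?_eq (show j ≤ m by omega)] at hB
          simp at hA hB
          subst hA hB
          have : insert m (Finset.range (j + 1)) ∩ insert (m + 1) (insert m (Finset.range j)) =
              insert m (Finset.range j) := by
            ext x
            simp only [Finset.mem_inter, Finset.mem_insert, Finset.mem_range]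
            omega
          rw [this, Finset.card_insert_of_notMem (by simp; omega), Finset.card_range]

end revolvingDoor

/-- For all `1 ≤ d < n`, the Johnson graph `J(n,d)` has a Hamiltonian path:
an enumeration `S_1, …, S_T` (`T = C(n,d)`) of all `d`-element subsets of
`{1,…,n}`, each appearing exactly once, with `|S_t ∩ S_{t+1}| = d - 1`. -/
theorem johnson_graph_hamiltonian_path (n d : ℕ) (hd : 1 ≤ d) (hdn : d < n) :
    ∃ S : Fin (n.choose d) → Finset (Fin n),
      (∀ t, (S t).card = d) ∧
      (∀ A : Finset (Fin n), A.card = d → ∃! t, S t = A) ∧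
      (∀ (t : ℕ) (ht : t + 1 < n.choose d),
        (S ⟨t, by omega⟩ ∩ S ⟨t + 1, ht⟩).card = d - 1) := by
  have hlen := revolvingDoor.length_eq n d
  have hmem (t : ℕ) (ht : t < (revolvingDoor n d).length) :
      (revolvingDoor n d)[t] ∈ revolvingDoor n d := List.getElem_mem ht
  have hS (t : Fin (n.choose d)) : ∃ B : Finset (Fin n),
      B.map Fin.valEmbedding = (revolvingDoor n d)[(t : ℕ)]'(t.2.trans_eq hlen.symm) := by
    refine ⟨Finset.univ.filter fun i => (i : ℕ) ∈
      (revolvingDoor n d)[(t : ℕ)]'(t.2.trans_eq hlen.symm), ?_⟩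
    ext x
    simp only [Finset.mem_map, Finset.mem_filter, Finset.mem_univ, true_and,
      Fin.valEmbedding_apply]
    exact ⟨fun ⟨i, hi, hx⟩ => hx ▸ hi, fun hx => ⟨⟨x, Finset.mem_range.1
      (revolvingDoor.subset_range (hmem t (t.2.trans_eq hlen.symm)) hx)⟩, hx, rfl⟩⟩
  choose S hS using hS
  refine ⟨S, fun t => ?_, fun A hA => ?_, fun t ht => ?_⟩
  · rw [← Finset.card_map Fin.valEmbedding, hS]
    exact revolvingDoor.card_eq (hmem _ _)
  · have hA' : A.map Fin.valEmbedding ∈ revolvingDoor n d := by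
      rw [revolvingDoor.mem_iff, Finset.mem_powersetCard, Finset.card_map]
      refine ⟨fun x hx => ?_, hA⟩
      obtain ⟨i, -, rfl⟩ := Finset.mem_map.1 hx
      simp
    obtain ⟨t, ht, hAt⟩ := List.getElem_of_mem hA'
    refine ⟨⟨t, hlen ▸ ht⟩, Finset.map_injective Fin.valEmbedding ((hS _).trans hAt), ?_⟩
    rintro s rfl
    rw [hS] at hAt
    exact Fin.ext ((revolvingDoor.nodup n d).getElem_inj_iff.1 hAt).symm
  · have h := List.isChain_iff_getElem.1 (revolvingDoor.isChain n d) t (by omega)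
    rw [← Finset.card_map Fin.valEmbedding, Finset.map_inter, hS, hS]
    exact Nat.eq_sub_of_add_eq h
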